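/- In the minimum-counterexample setup, for every acyclic edge coloring c of G−xy using Δ+1 colors and every color γ ∈ C − F_x(c), there exists a (ν,γ,x,y')-maximal bichromatic path with respect to c, where ν is the element of F''_x(c) other than c(y,y') (F''_x(c) has exactly two elements, one of which is c(y,y')). -/

import Mathlib

open SimpleGraph

namespace AEC

variable {V : Type*}

/-- The set of colors appearing (under partial coloring `c`) on colored edges incident
with the vertex `u` (i.e. `F_u`). -/
def colorsAt (G : SimpleGraph V) (c : Sym2 V → Option ℕ) (u : V) : Set ℕ :=
  {γ | ∃ z, G.Adj u z ∧ c s(u, z) = some γ}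

/-- `S_ab`: the set of colors appearing on the colored edges incident with `b`
other than the edge `ab`. -/
def Sset (G : SimpleGraph V) (c : Sym2 V → Option ℕ) (a b : V) : Set ℕ :=
  {γ | ∃ z, G.Adj b z ∧ z ≠ a ∧ c s(b, z) = some γ}

/-- A partial edge coloring (colors are `ℕ`, `none` = uncolored): it may only color
edges of `G`, and colored edges sharing an endpoint receive distinct colors. -/
def ProperPartialColoring (G : SimpleGraph V) (c : Sym2 V → Option ℕ) : Prop :=
  (∀ e, (c e).isSome → e ∈ G.edgeSet) ∧
  ∀ ⦃u v w : V⦄, G.Adj u v → G.Adj u w → v ≠ w → (c s(u, v)).isSome →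
    c s(u, v) ≠ c s(u, w)

/-- A valid (acyclic) partial coloring: proper, and no cycle of `G` is bichromatic,
i.e. no cycle has all of its edges colored using only two colors. -/
def AcyclicPartialColoring (G : SimpleGraph V) (c : Sym2 V → Option ℕ) : Prop :=
  ProperPartialColoring G c ∧
  ∀ (α β : ℕ) (v : V) (W : G.Walk v v), W.IsCycle →
    ¬ ∀ e ∈ W.edges, c e = some α ∨ c e = some β

/-- An acyclic edge coloring of `G` using (at most) `k` colors: a valid partial coloring
that colors every edge of `G` with a color `< k`. -/
def IsAcyclicEdgeColoring (G : SimpleGraph V) (k : ℕ) (c : Sym2 V → Option ℕ) : Prop :=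
  AcyclicPartialColoring G c ∧ ∀ e ∈ G.edgeSet, ∃ a, a < k ∧ c e = some a

/-- `G` is 2-degenerate: every nonempty (induced) subgraph has a vertex of degree at most 2. -/
def TwoDegenerate [DecidableEq V] (G : SimpleGraph V) [DecidableRel G.Adj] : Prop :=
  ∀ s : Finset V, s.Nonempty → ∃ v ∈ s, (s.filter fun u => G.Adj v u).card ≤ 2

/-- A maximal `(α,β)`-bichromatic path from `a` to `b`: a path all of whose edges are
colored `α` or `β`, which cannot be extended at either end. -/
def IsMaximalBichromaticPath (G : SimpleGraph V) (c : Sym2 V → Option ℕ)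
    (α β : ℕ) {a b : V} (W : G.Walk a b) : Prop :=
  W.IsPath ∧ (∀ e ∈ W.edges, c e = some α ∨ c e = some β) ∧
  (∀ w, G.Adj a w → (c s(a, w) = some α ∨ c s(a, w) = some β) → w ∈ W.support) ∧
  (∀ w, G.Adj b w → (c s(b, w) = some α ∨ c s(b, w) = some β) → w ∈ W.support)

/-- An `(α,β,a,b)`-maximal bichromatic path: a maximal `(α,β)`-bichromatic path from
`a` to `b` whose edge incident on `a` is colored `α`. -/
def IsMaxBichromaticPathFrom (G : SimpleGraph V) (c : Sym2 V → Option ℕ)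
    (α β : ℕ) {a b : V} (W : G.Walk a b) : Prop :=
  IsMaximalBichromaticPath G c α β W ∧ ∃ e, W.edges.head? = some e ∧ c e = some α

/-- An `(α,β,ab)`-critical path: a maximal `(α,β)`-bichromatic path from `a` to `b` whose
edges incident on `a` and on `b` are both colored `α`. -/
def IsCriticalPath (G : SimpleGraph V) (c : Sym2 V → Option ℕ)
    (α β : ℕ) {a b : V} (W : G.Walk a b) : Prop :=
  IsMaxBichromaticPathFrom G c α β W ∧ ∃ e, W.edges.getLast? = some e ∧ c e = some α

/-- `F''_x(c)`: colors of edges from `x` to its neighbors (other than `y`) of degree ≥ 3. -/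
def Fpp [Fintype V] (G : SimpleGraph V) [DecidableRel G.Adj]
    (c : Sym2 V → Option ℕ) (x y : V) : Set ℕ :=
  {γ | ∃ z, G.Adj x z ∧ z ≠ y ∧ 3 ≤ G.degree z ∧ c s(x, z) = some γ}

/-- `F'_x(c)`: colors of edges from `x` to its neighbors (other than `y`) of degree 2. -/
def Fp [Fintype V] (G : SimpleGraph V) [DecidableRel G.Adj]
    (c : Sym2 V → Option ℕ) (x y : V) : Set ℕ :=
  {γ | ∃ z, G.Adj x z ∧ z ≠ y ∧ G.degree z = 2 ∧ c s(x, z) = some γ}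

/-- `F_x(c) = F'_x(c) ∪ F''_x(c)`. -/
def Fx [Fintype V] (G : SimpleGraph V) [DecidableRel G.Adj]
    (c : Sym2 V → Option ℕ) (x y : V) : Set ℕ :=
  Fp G c x y ∪ Fpp G c x y

/-- The spanning subgraph of `G` formed by the edges colored `α` or `β`. -/
def bichromaticSubgraph (G : SimpleGraph V) (c : Sym2 V → Option ℕ) (α β : ℕ) :
    SimpleGraph V where
  Adj u v := G.Adj u v ∧ (c s(u, v) = some α ∨ c s(u, v) = some β)
  symm := ⟨fun u v h => by rw [Sym2.eq_swap]; exact ⟨h.1.symm, h.2⟩⟩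
  loopless := ⟨fun u h => G.loopless.irrefl u h.1⟩

theorem bichromaticSubgraph_le (G : SimpleGraph V) (c : Sym2 V → Option ℕ) (α β : ℕ) :
    bichromaticSubgraph G c α β ≤ G := fun _ _ h => h.1

theorem color_of_mem_edgeSet_bichromaticSubgraph {G : SimpleGraph V} {c : Sym2 V → Option ℕ}
    {α β : ℕ} {e : Sym2 V} (h : e ∈ (bichromaticSubgraph G c α β).edgeSet) :
    c e = some α ∨ c e = some β := by
  induction e with
  | h u v => exact h.2

theorem mem_edgeSet_bichromaticSubgraph {G : SimpleGraph V} {c : Sym2 V → Option ℕ}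
    {α β : ℕ} {e : Sym2 V} (he : e ∈ G.edgeSet) (h : c e = some α ∨ c e = some β) :
    e ∈ (bichromaticSubgraph G c α β).edgeSet := by
  induction e with
  | h u v => exact ⟨he, h⟩

theorem ProperPartialColoring.eq_of_color_eq {G : SimpleGraph V} {c : Sym2 V → Option ℕ}
    (hc : ProperPartialColoring G c) {u v w : V} {α : ℕ} (hv : G.Adj u v) (hw : G.Adj u w)
    (hcv : c s(u, v) = some α) (hcw : c s(u, w) = some α) : v = w := by
  by_contra h
  exact hc.2 hv hw h (by simp [hcv]) (hcv.trans hcw.symm)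

theorem ProperPartialColoring.update [DecidableEq V] {G : SimpleGraph V}
    {c : Sym2 V → Option ℕ} {x y : V} {γ : ℕ} (hxy : G.Adj x y)
    (hc : ProperPartialColoring (G.deleteEdges {s(x, y)}) c)
    (hγx : γ ∉ colorsAt (G.deleteEdges {s(x, y)}) c x)
    (hγy : γ ∉ colorsAt (G.deleteEdges {s(x, y)}) c y) :
    ProperPartialColoring G (Function.update c s(x, y) (some γ)) := by
  have hnone : ∀ u v w, G.Adj u v → v ≠ w → s(u, w) = s(x, y) → c s(u, v) ≠ some γ := by
    intro u v w huv hvw he hcv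
    have hne : s(u, v) ≠ s(x, y) := by
      rw [← he]; exact fun h => hvw (Sym2.congr_right.1 h)
    have hadj : (G.deleteEdges {s(x, y)}).Adj u v := by
      simp only [deleteEdges_adj, Set.mem_singleton_iff]; exact ⟨huv, hne⟩
    rcases Sym2.eq_iff.1 he with ⟨rfl, rfl⟩ | ⟨rfl, rfl⟩
    · exact hγx ⟨v, hadj, hcv⟩
    · exact hγy ⟨v, hadj, hcv⟩
  refine ⟨fun e he => ?_, fun u v w huv huw hvw hs => ?_⟩
  · by_cases h : e = s(x, y)
    · subst h; exact hxy
    · rw [Function.update_of_ne h] at he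
      exact edgeSet_mono (deleteEdges_le _) (hc.1 e he)
  · by_cases h1 : s(u, v) = s(x, y)
    · have h2 : s(u, w) ≠ s(x, y) := by
        rw [← h1]; exact fun h => hvw (Sym2.congr_right.1 h).symm
      rw [h1, Function.update_self, Function.update_of_ne h2]
      exact (hnone u w v huw hvw.symm h1).symm
    · by_cases h2 : s(u, w) = s(x, y)
      · rw [h2, Function.update_self, Function.update_of_ne h1]
        exact hnone u v w huv hvw h2
      · rw [Function.update_of_ne h1] at hs ⊢
        rw [Function.update_of_ne h2]
        refine hc.2 ?_ ?_ hvw hs <;> simp [*]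

/-- Giving color `γ` to the deleted edge `xy` keeps the coloring acyclic when `γ` is missing at
both ends and no bichromatic path using `γ` joins them. -/
theorem IsAcyclicEdgeColoring.update [DecidableEq V] {G : SimpleGraph V} {k : ℕ}
    {c : Sym2 V → Option ℕ} {x y : V} {γ : ℕ} (hxy : G.Adj x y)
    (hc : IsAcyclicEdgeColoring (G.deleteEdges {s(x, y)}) k c) (hγ : γ < k)
    (hγx : γ ∉ colorsAt (G.deleteEdges {s(x, y)}) c x)
    (hγy : γ ∉ colorsAt (G.deleteEdges {s(x, y)}) c y)
    (hreach : ∀ β, ¬ (bichromaticSubgraph (G.deleteEdges {s(x, y)}) c γ β).Reachable x y) :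
    IsAcyclicEdgeColoring G k (Function.update c s(x, y) (some γ)) := by
  obtain ⟨⟨hprop, hcyc⟩, hcol⟩ := hc
  refine ⟨⟨hprop.update hxy hγx hγy, ?_⟩, fun e he => ?_⟩
  · intro α β v W hW hbi
    by_cases hmem : s(x, y) ∈ W.edges
    · set K := bichromaticSubgraph G (Function.update c s(x, y) (some γ)) α β with hK
      have hWK : ∀ e ∈ W.edges, e ∈ K.edgeSet := fun e he =>
        mem_edgeSet_bichromaticSubgraph (W.edges_subset_edgeSet he) (hbi e he)
      have hr := (adj_and_reachable_delete_edges_iff_exists_cycle (G := K) (v := x) (w := y)).2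
        ⟨v, W.transfer K hWK, hW.transfer hWK, by simpa using hmem⟩
      have hγab : γ = α ∨ γ = β := by simpa using hbi _ hmem
      have hle : ∀ δ, (∀ η, η = α ∨ η = β → η = γ ∨ η = δ) →
          K \ fromEdgeSet {s(x, y)} ≤
            bichromaticSubgraph (G.deleteEdges {s(x, y)}) c γ δ := by
        intro δ hδ u w huw
        rw [sdiff_adj, fromEdgeSet_adj] at huw
        obtain ⟨⟨h1, h2⟩, h3⟩ := huw
        have hne : s(u, w) ≠ s(x, y) := fun h => h3 ⟨h, h1.ne⟩
        rw [Function.update_of_ne hne] at h2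
        refine ⟨?_, ?_⟩
        · simp only [deleteEdges_adj, Set.mem_singleton_iff]; exact ⟨h1, hne⟩
        · rcases h2 with h2 | h2 <;> rw [h2] <;> simp only [Option.some.injEq]
          · exact hδ _ (Or.inl rfl)
          · exact hδ _ (Or.inr rfl)
      rcases hγab with rfl | rfl
      · exact hreach β (hr.2.mono (hle β fun _ h => h))
      · exact hreach α (hr.2.mono (hle α fun _ h => h.symm))
    · have hWH : ∀ e ∈ W.edges, e ∈ (G.deleteEdges {s(x, y)}).edgeSet := by
        intro e he
        rw [edgeSet_deleteEdges]
        exact ⟨W.edges_subset_edgeSet he, fun h => hmem (by rwa [← Set.mem_singleton_iff.1 h])⟩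
      refine hcyc α β v (W.transfer _ hWH) (hW.transfer hWH) fun e he => ?_
      rw [Walk.edges_transfer] at he
      have hne : e ≠ s(x, y) := fun h => hmem (h ▸ he)
      simpa [Function.update_of_ne hne] using hbi e he
  · by_cases h : e = s(x, y)
    · exact ⟨γ, hγ, by simp [h]⟩
    · rw [Function.update_of_ne h]
      exact hcol e (by rw [edgeSet_deleteEdges]; exact ⟨he, h⟩)

theorem IsAcyclicEdgeColoring.deleteEdge [DecidableEq V] {G : SimpleGraph V} {k : ℕ}
    {c : Sym2 V → Option ℕ} (hc : IsAcyclicEdgeColoring G k c) (e : Sym2 V) :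
    IsAcyclicEdgeColoring (G.deleteEdges {e}) k (Function.update c e none) := by
  obtain ⟨⟨⟨hsupp, hprop⟩, hcyc⟩, hcol⟩ := hc
  have hne : ∀ f ∈ (G.deleteEdges {e}).edgeSet, f ≠ e := by
    intro f hf
    rw [edgeSet_deleteEdges] at hf
    exact hf.2
  have hle : G.deleteEdges {e} ≤ G := deleteEdges_le _
  refine ⟨⟨⟨fun f hf => ?_, fun u v w huv huw hvw hs => ?_⟩, fun α β v W hW hbi => ?_⟩,
    fun f hf => ?_⟩
  · by_cases h : f = e
    · simp [h] at hf
    · rw [Function.update_of_ne h] at hf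
      rw [edgeSet_deleteEdges]
      exact ⟨hsupp f hf, h⟩
  · rw [Function.update_of_ne (hne _ huv)] at hs ⊢
    rw [Function.update_of_ne (hne _ huw)]
    exact hprop (hle huv) (hle huw) hvw hs
  · refine hcyc α β v (W.mapLe hle) (hW.mapLe hle) fun f hf => ?_
    rw [Walk.edges_mapLe_eq_edges] at hf
    simpa [Function.update_of_ne (hne f (W.edges_subset_edgeSet hf))] using hbi f hf
  · rw [Function.update_of_ne (hne f hf)]
    exact hcol f (edgeSet_mono hle hf)

/-- A pendant edge `yz` (with `y` of degree one) that has been deleted can be given any color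
missing at `z`. -/
theorem IsAcyclicEdgeColoring.update_pendant [DecidableEq V] {G : SimpleGraph V} {k : ℕ}
    {c : Sym2 V → Option ℕ} {y z : V} {γ : ℕ} (hyz : G.Adj y z) (hpend : ∀ w, G.Adj y w → w = z)
    (hc : IsAcyclicEdgeColoring (G.deleteEdges {s(y, z)}) k c) (hγ : γ < k)
    (hγz : γ ∉ colorsAt (G.deleteEdges {s(y, z)}) c z) :
    IsAcyclicEdgeColoring G k (Function.update c s(y, z) (some γ)) := by
  have hiso : ∀ w, ¬ (G.deleteEdges {s(y, z)}).Adj y w := by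
    intro w h
    rw [deleteEdges_adj] at h
    exact h.2 (by rw [hpend w h.1]; rfl)
  refine hc.update hyz hγ (fun ⟨w, hw, _⟩ => hiso w hw) hγz fun β ⟨p⟩ => ?_
  cases p with
  | nil => exact hyz.ne rfl
  | cons h _ => exact hiso _ h.1

/-- A pendant edge may be recolored with any color missing at its other end. -/
theorem IsAcyclicEdgeColoring.recolor_pendant [DecidableEq V] {G : SimpleGraph V} {k : ℕ}
    {c : Sym2 V → Option ℕ} {y z : V} {γ : ℕ} (hyz : G.Adj y z) (hpend : ∀ w, G.Adj y w → w = z)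
    (hc : IsAcyclicEdgeColoring G k c) (hγ : γ < k) (hγz : γ ∉ colorsAt G c z) :
    IsAcyclicEdgeColoring G k (Function.update c s(y, z) (some γ)) := by
  have h := (hc.deleteEdge s(y, z)).update_pendant (γ := γ) hyz hpend hγ ?_
  · simpa using h
  · rintro ⟨w, hw, hcw⟩
    have hne : s(z, w) ≠ s(y, z) := by
      rw [deleteEdges_adj] at hw
      exact hw.2
    rw [Function.update_of_ne hne] at hcw
    exact hγz ⟨w, deleteEdges_le _ hw, hcw⟩

open Classical in
theorem le_card_missing_colors {G : SimpleGraph V} (c : Sym2 V → Option ℕ) {u : V}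
    {N : Finset V} {k m : ℕ} (hN : ∀ z, G.Adj u z → z ∈ N) (hk : N.card + m ≤ k) :
    m ≤ ((Finset.range k).filter (· ∉ colorsAt G c u)).card := by
  set S := N.image fun z => (c s(u, z)).getD 0
  have hsub : Finset.range k \ S ⊆ (Finset.range k).filter (· ∉ colorsAt G c u) := by
    intro a ha
    rw [Finset.mem_sdiff] at ha
    rw [Finset.mem_filter]
    refine ⟨ha.1, fun ⟨z, hz, hcz⟩ => ha.2 ?_⟩
    exact Finset.mem_image.2 ⟨z, hN z hz, by simp [hcz]⟩
  have h1 := Finset.card_le_card hsub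
  have h2 := Finset.le_card_sdiff S (Finset.range k)
  have h3 : S.card ≤ N.card := Finset.card_image_le
  rw [Finset.card_range] at h2
  omega

theorem exists_missing_color [Fintype V] [DecidableEq V] (G : SimpleGraph V)
    [DecidableRel G.Adj] {H : SimpleGraph V} (hH : H ≤ G) (c : Sym2 V → Option ℕ) (u : V) :
    ∃ a < G.maxDegree + 1, a ∉ colorsAt H c u := by
  classical
  have h := le_card_missing_colors c (G := H) (u := u) (N := G.neighborFinset u)
    (k := G.maxDegree + 1) (m := 1) (fun z hz => by simpa using hH hz)
    (by rw [card_neighborFinset_eq_degree]; have := G.degree_le_maxDegree u; omega)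
  obtain ⟨a, ha⟩ := Finset.card_pos.1 h
  rw [Finset.mem_filter, Finset.mem_range] at ha
  exact ⟨a, ha.1, ha.2⟩

theorem exists_two_missing_colors [Fintype V] [DecidableEq V] (G : SimpleGraph V)
    [DecidableRel G.Adj] {x y : V} (hxy : G.Adj x y) (c : Sym2 V → Option ℕ) :
    ∃ a b, a < G.maxDegree + 1 ∧ b < G.maxDegree + 1 ∧ a ≠ b ∧
      a ∉ colorsAt (G.deleteEdges {s(x, y)}) c x ∧
      b ∉ colorsAt (G.deleteEdges {s(x, y)}) c x := by
  classical
  have hmem : y ∈ G.neighborFinset x := by simpa using hxy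
  have hN : ∀ z, (G.deleteEdges {s(x, y)}).Adj x z → z ∈ (G.neighborFinset x).erase y := by
    intro z hz
    rw [deleteEdges_adj] at hz
    rw [Finset.mem_erase]
    exact ⟨fun h => hz.2 (by rw [h]; rfl), by simpa using hz.1⟩
  have hpos := Finset.card_pos.2 ⟨y, hmem⟩
  have h := le_card_missing_colors c hN (k := G.maxDegree + 1) (m := 2) (by
    rw [Finset.card_erase_of_mem hmem]
    rw [card_neighborFinset_eq_degree] at hpos ⊢
    have := G.degree_le_maxDegree x
    omega)
  obtain ⟨a, ha, b, hb, hab⟩ := Finset.one_lt_card.1 h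
  rw [Finset.mem_filter, Finset.mem_range] at ha hb
  exact ⟨a, b, ha.1, hb.1, hab, ha.2, hb.2⟩

/-- A graph with no acyclic edge coloring, all of whose edge-deleted subgraphs have one, has no
vertex of degree one. -/
theorem degree_ne_one_of_minimal [Fintype V] [DecidableEq V] (G : SimpleGraph V)
    [DecidableRel G.Adj]
    (hmin : ¬ ∃ c : Sym2 V → Option ℕ, IsAcyclicEdgeColoring G (G.maxDegree + 1) c)
    (hdel : ∀ e ∈ G.edgeSet, ∃ c : Sym2 V → Option ℕ,
      IsAcyclicEdgeColoring (G.deleteEdges {e}) (G.maxDegree + 1) c) (z : V) :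
    G.degree z ≠ 1 := by
  intro h
  obtain ⟨x, hx, huniq⟩ := degree_eq_one_iff_existsUnique_adj.1 h
  obtain ⟨c, hc⟩ := hdel s(z, x) hx
  obtain ⟨a, ha, hax⟩ := exists_missing_color G (deleteEdges_le {s(z, x)}) c x
  exact hmin ⟨_, hc.update_pendant hx huniq ha hax⟩

theorem exists_adj_color_of_missing {G : SimpleGraph V} {c : Sym2 V → Option ℕ} {α β : ℕ}
    {a b : V} (W : G.Walk a b) (hab : a ≠ b)
    (hbi : ∀ e ∈ W.edges, c e = some α ∨ c e = some β) (hβ : β ∉ colorsAt G c a) :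
    ∃ z, G.Adj a z ∧ c s(a, z) = some α ∧ z ∈ W.support ∧ W.edges.head? = some s(a, z) := by
  cases W with
  | nil => exact absurd rfl hab
  | @cons _ z _ h q =>
    refine ⟨z, h, ?_, by simp, by simp⟩
    exact (hbi s(a, z) (by simp)).resolve_right fun hc => hβ ⟨z, h, hc⟩

/-- If the deleted edge `xy` cannot be given the color `γ` missing at `x`, then a
`(μ, γ)`-bichromatic path joins `x` to `y'`, where `μ` is the color of the only other edge `yy'`
at `y`. -/
theorem exists_bichromatic_path_of_not_colorable [DecidableEq V] {G : SimpleGraph V} {k : ℕ}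
    (hmin : ¬ ∃ c : Sym2 V → Option ℕ, IsAcyclicEdgeColoring G k c)
    {c : Sym2 V → Option ℕ} {x y y' : V} {μ γ : ℕ} (hxy : G.Adj x y)
    (hc : IsAcyclicEdgeColoring (G.deleteEdges {s(x, y)}) k c)
    (hy : ∀ w, (G.deleteEdges {s(x, y)}).Adj y w → w = y') (hμ : c s(y, y') = some μ)
    (hγ : γ < k) (hγμ : γ ≠ μ) (hγx : γ ∉ colorsAt (G.deleteEdges {s(x, y)}) c x) :
    ∃ W : (G.deleteEdges {s(x, y)}).Walk x y', W.IsPath ∧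
      (∀ e ∈ W.edges, c e = some μ ∨ c e = some γ) ∧ y ∉ W.support := by
  have hγy : γ ∉ colorsAt (G.deleteEdges {s(x, y)}) c y := by
    rintro ⟨w, hw, hcw⟩
    rw [hy w hw, hμ] at hcw
    exact hγμ (Option.some.inj hcw).symm
  have : ∃ β, (bichromaticSubgraph (G.deleteEdges {s(x, y)}) c γ β).Reachable x y := by
    by_contra! h
    exact hmin ⟨_, hc.update hxy hγ hγx hγy h⟩
  obtain ⟨β, hβ⟩ := this
  obtain ⟨p, hp⟩ := hβ.symm.exists_isPath
  cases p with
  | nil => exact absurd rfl hxy.ne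
  | @cons _ u _ h q =>
    obtain rfl : u = y' := hy u h.1
    rw [Walk.cons_isPath_iff] at hp
    have hβμ : β = μ := by
      rcases h.2 with h2 | h2 <;> rw [hμ] at h2
      · exact absurd (Option.some.inj h2).symm hγμ
      · exact (Option.some.inj h2).symm
    subst hβμ
    refine ⟨(q.mapLe (bichromaticSubgraph_le _ _ _ _)).reverse, ?_, fun e he => ?_, ?_⟩
    · exact (hp.1.mapLe _).reverse
    · rw [Walk.edges_reverse, List.mem_reverse, Walk.edges_mapLe_eq_edges] at he
      exact (color_of_mem_edgeSet_bichromaticSubgraph (q.edges_subset_edgeSet he)).symm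
    · rw [Walk.support_reverse, List.mem_reverse, Walk.support_mapLe_eq_support]
      exact hp.2

/-- In a minimum counterexample, the color of `yy'` also appears on an edge from `x` to a
neighbor of degree at least three. -/
theorem color_mem_Fpp_of_not_colorable [Fintype V] [DecidableEq V] {G : SimpleGraph V}
    [DecidableRel G.Adj]
    (hmin : ¬ ∃ c : Sym2 V → Option ℕ, IsAcyclicEdgeColoring G (G.maxDegree + 1) c)
    {c : Sym2 V → Option ℕ} {x y y' : V} {μ : ℕ} (hxy : G.Adj x y)
    (hc : IsAcyclicEdgeColoring (G.deleteEdges {s(x, y)}) (G.maxDegree + 1) c)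
    (hyy' : (G.deleteEdges {s(x, y)}).Adj y y') (hy'x : y' ≠ x)
    (hy : ∀ w, (G.deleteEdges {s(x, y)}).Adj y w → w = y') (hμ : c s(y, y') = some μ) :
    μ ∈ Fpp G c x y := by
  have hle : G.deleteEdges {s(x, y)} ≤ G := deleteEdges_le _
  have hprop := hc.1.1
  obtain ⟨γ₁, γ₂, h₁, h₂, h₁₂, hx₁, hx₂⟩ := exists_two_missing_colors G hxy c
  have key : ∀ γ < G.maxDegree + 1, γ ∉ colorsAt (G.deleteEdges {s(x, y)}) c x → γ ≠ μ →
      ∃ z w, (G.deleteEdges {s(x, y)}).Adj x z ∧ c s(x, z) = some μ ∧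
        G.Adj z w ∧ w ≠ x ∧ c s(z, w) = some γ := by
    intro γ hγ hγx hγμ
    obtain ⟨W, hW, hbi, -⟩ :=
      exists_bichromatic_path_of_not_colorable hmin hxy hc hy hμ hγ hγμ hγx
    cases W with
    | nil => exact absurd rfl hy'x
    | @cons _ z _ h q =>
      have hcz : c s(x, z) = some μ :=
        (hbi s(x, z) (by simp)).resolve_right fun hc => hγx ⟨z, h, hc⟩
      rw [Walk.cons_isPath_iff] at hW
      cases q with
      | nil =>
        refine absurd (hprop.eq_of_color_eq (α := μ) h.symm hyy'.symm ?_ ?_) hxy.ne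
        · rwa [Sym2.eq_swap]
        · rwa [Sym2.eq_swap]
      | @cons _ w _ h' q' =>
        have hwx : w ≠ x := by
          rintro rfl
          exact hW.2 (by simp)
        refine ⟨z, w, h, hcz, hle h', hwx, (hbi s(z, w) (by simp)).resolve_left fun hcw => ?_⟩
        exact hwx (hprop.eq_of_color_eq h' h.symm hcw (by rwa [Sym2.eq_swap]))
  have hμx : μ ∈ colorsAt (G.deleteEdges {s(x, y)}) c x := by
    by_cases h : γ₁ = μ
    · obtain ⟨z, w, hz, hcz, -⟩ := key γ₂ h₂ hx₂ fun h' => h₁₂ (h.trans h'.symm)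
      exact ⟨z, hz, hcz⟩
    · obtain ⟨z, w, hz, hcz, -⟩ := key γ₁ h₁ hx₁ h
      exact ⟨z, hz, hcz⟩
  obtain ⟨z, w₁, hz, hcz, hw₁, hw₁x, hcw₁⟩ := key γ₁ h₁ hx₁ fun h => hx₁ (h ▸ hμx)
  obtain ⟨z', w₂, hz', hcz', hw₂, hw₂x, hcw₂⟩ := key γ₂ h₂ hx₂ fun h => hx₂ (h ▸ hμx)
  obtain rfl : z = z' := hprop.eq_of_color_eq hz hz' hcz hcz'
  have hw₁₂ : w₁ ≠ w₂ := by
    rintro rfl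
    exact h₁₂ (Option.some.inj (hcw₁.symm.trans hcw₂))
  refine ⟨z, hle hz, ?_, ?_, hcz⟩
  · rintro rfl
    simp at hz
  · rw [← card_neighborFinset_eq_degree]
    refine Finset.two_lt_card.2 ⟨x, ?_, w₁, ?_, w₂, ?_, hw₁x.symm, hw₂x.symm, hw₁₂⟩
    · simpa using (hle hz).symm
    · simpa using hw₁
    · simpa using hw₂

/-- At most two colors appear on the edges from `x` to its neighbors of degree at least three. -/
theorem eq_or_eq_of_mem_Fpp [Fintype V] [DecidableEq V] {G : SimpleGraph V}
    [DecidableRel G.Adj] {c : Sym2 V → Option ℕ} {x y : V} {α β δ : ℕ}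
    (hx : ((G.neighborFinset x).filter fun z => 3 ≤ G.degree z).card ≤ 2)
    (hα : α ∈ Fpp G c x y) (hβ : β ∈ Fpp G c x y) (hδ : δ ∈ Fpp G c x y) (hαβ : α ≠ β) :
    δ = α ∨ δ = β := by
  by_contra! h
  obtain ⟨a, ha, -, hda, hca⟩ := hα
  obtain ⟨b, hb, -, hdb, hcb⟩ := hβ
  obtain ⟨d, hd, -, hdd, hcd⟩ := hδ
  have hne : ∀ {u v : V} {η θ : ℕ}, c s(x, u) = some η → c s(x, v) = some θ → η ≠ θ → u ≠ v := by
    rintro u _ η θ hu hv hηθ rfl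
    exact hηθ (Option.some.inj (hu.symm.trans hv))
  refine absurd hx (not_le.2 (Finset.two_lt_card.2 ⟨a, ?_, b, ?_, d, ?_, hne hca hcb hαβ,
    hne hca hcd h.1.symm, hne hcb hcd h.2.symm⟩)) <;> simp [*]

/-- Lemma 6: in the minimum-counterexample setup, for every color
`γ ∈ C − F_x(c)` there exists a `(ν,γ,x,y')`-maximal bichromatic path with respect to
`c`, where `ν` is the element of `F''_x(c)` other than `c(y,y')`. -/
theorem maxBichromaticPath_of_not_mem_Fx
    {V : Type*} [Fintype V] [DecidableEq V] (G : SimpleGraph V) [DecidableRel G.Adj]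
    (h2deg : TwoDegenerate G)
    (hmin : ¬ ∃ c : Sym2 V → Option ℕ, IsAcyclicEdgeColoring G (G.maxDegree + 1) c)
    (hdel : ∀ e ∈ G.edgeSet, ∃ c : Sym2 V → Option ℕ,
      IsAcyclicEdgeColoring (G.deleteEdges {e}) (G.maxDegree + 1) c)
    (x : V)
    (hxdeg2 : ∃ z, G.Adj x z ∧ G.degree z = 2)
    (hxdeg3 : ((G.neighborFinset x).filter fun z => 3 ≤ G.degree z).card ≤ 2)
    (y y' : V) (hxy : G.Adj x y) (hy2 : G.degree y = 2)
    (hyy' : G.Adj y y') (hy'x : y' ≠ x)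
    (c : Sym2 V → Option ℕ)
    (hc : IsAcyclicEdgeColoring (G.deleteEdges {s(x, y)}) (G.maxDegree + 1) c)
    (μ ν γ : ℕ) (hμ : c s(y, y') = some μ)
    (hν : ν ∈ Fpp G c x y) (hνμ : ν ≠ μ)
    (hγC : γ < G.maxDegree + 1) (hγF : γ ∉ Fx G c x y) :
    ∃ W : (G.deleteEdges {s(x, y)}).Walk x y',
      IsMaxBichromaticPathFrom (G.deleteEdges {s(x, y)}) c ν γ W := by
  have hHadj : ∀ {u v}, (G.deleteEdges {s(x, y)}).Adj u v ↔ G.Adj u v ∧ s(u, v) ≠ s(x, y) := by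
    intro u v
    rw [deleteEdges_adj, Set.mem_singleton_iff]
  have hHle : G.deleteEdges {s(x, y)} ≤ G := deleteEdges_le _
  have hprop := hc.1.1
  have hyy'H : (G.deleteEdges {s(x, y)}).Adj y y' :=
    hHadj.2 ⟨hyy', fun h => hy'x (Sym2.congr_right.1 (h.trans Sym2.eq_swap))⟩
  have hy : ∀ w, (G.deleteEdges {s(x, y)}).Adj y w → w = y' := by
    intro w hw
    by_contra hwy'
    have hwx : w ≠ x := by
      rintro rfl
      exact (hHadj.1 hw).2 Sym2.eq_swap
    rw [← card_neighborFinset_eq_degree] at hy2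
    have h3 : 2 < (G.neighborFinset y).card :=
      Finset.two_lt_card.2 ⟨x, by simpa using hxy.symm, y', by simpa using hyy', w,
        by simpa using hHle hw, hy'x.symm, hwx.symm, Ne.symm hwy'⟩
    omega
  have hne_x : ∀ z, s(x, z) ≠ s(y, y') := by
    intro z h
    rcases Sym2.eq_iff.1 h with ⟨h, -⟩ | ⟨h, -⟩
    · exact hxy.ne h
    · exact hy'x h.symm
  have hμy' : μ ∈ colorsAt (G.deleteEdges {s(x, y)}) c y' :=
    ⟨y, hyy'H.symm, by rwa [Sym2.eq_swap]⟩
  have hμF := color_mem_Fpp_of_not_colorable hmin hxy hc hyy'H hy'x hy hμ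
  obtain ⟨η, hη, hηy'⟩ := exists_missing_color G hHle c y'
  have hrec := hc.recolor_pendant hyy'H hy hη hηy'
  have hηF : η ∈ Fpp G c x y := by
    obtain ⟨z, h1, h2, h3, h4⟩ := color_mem_Fpp_of_not_colorable hmin hxy hrec hyy'H hy'x hy
      (Function.update_self _ _ _)
    rw [Function.update_of_ne (hne_x z)] at h4
    exact ⟨z, h1, h2, h3, h4⟩
  obtain rfl : η = ν := (eq_or_eq_of_mem_Fpp hxdeg3 hμF hν hηF hνμ.symm).resolve_left
    fun h => hηy' (h ▸ hμy')
  have hγη : γ ≠ η := fun h => hγF (Or.inr (h ▸ hν))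
  have hγx : γ ∉ colorsAt (G.deleteEdges {s(x, y)}) c x := by
    rintro ⟨z, hz, hcz⟩
    have hxz := hHle hz
    have hzy : z ≠ y := fun h => (hHadj.1 hz).2 (by rw [h])
    have h0 : 0 < G.degree z := (G.degree_pos_iff_exists_adj z).2 ⟨x, hxz.symm⟩
    have h1 := degree_ne_one_of_minimal G hmin hdel z
    by_cases h2 : G.degree z = 2
    · exact hγF (Or.inl ⟨z, hxz, hzy, h2, hcz⟩)
    · exact hγF (Or.inr ⟨z, hxz, hzy, by omega, hcz⟩)
  obtain ⟨W, hW, hbi', hyW⟩ := exists_bichromatic_path_of_not_colorable hmin hxy hrec hy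
    (Function.update_self _ _ _) hγC hγη (by
      rintro ⟨z, hz, hcz⟩
      rw [Function.update_of_ne (hne_x z)] at hcz
      exact hγx ⟨z, hz, hcz⟩)
  have hbi : ∀ e ∈ W.edges, c e = some η ∨ c e = some γ := by
    intro e he
    have hne : e ≠ s(y, y') := by
      rintro rfl
      exact hyW (W.fst_mem_support_of_mem_edges he)
    simpa [Function.update_of_ne hne] using hbi' e he
  obtain ⟨z, hz, hcz, hzW, hhead⟩ := exists_adj_color_of_missing W hy'x.symm hbi hγx
  obtain ⟨u, hu, hcu, huW, -⟩ := exists_adj_color_of_missing W.reverse hy'x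
    (fun e he => (hbi e (by simpa using he)).symm) hηy'
  refine ⟨W, ⟨hW, hbi, ?_, ?_⟩, _, hhead, hcz⟩
  · rintro w hw (hcw | hcw)
    · rwa [hprop.eq_of_color_eq hw hz hcw hcz]
    · exact absurd ⟨w, hw, hcw⟩ hγx
  · rintro w hw (hcw | hcw)
    · exact absurd ⟨w, hw, hcw⟩ hηy'
    · rw [hprop.eq_of_color_eq hw hu hcw hcu]
      simpa using huW

end AEC
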